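/- Let (W, N, (D_W)) be a non-constant windowed distribution system on X over a window system on (T, Σ_T) with W finite, and fix W* ∈ W. Then there exists a unique measure P_T on Σ_T that is compatible with the WDS and satisfies P_T(W*) = 1. Moreover, if (W̃, Ñ, (D̃_W)) is another non-constant WDS on a coarser measurable space (T, S) with S ⊆ Σ_T, W* ∈ W̃ ⊆ W, Ñ ⊆ N, and D̃_W = D_W for all W ∈ W̃, then the measure P̃_T obtained for it is the restriction of P_T to S. -/

import Mathlib

open MeasureTheory Set Filter Topology
open scoped ENNReal

/-- A window system `(𝒲, 𝒩)` on `T` with respect to the σ-algebra `m`. -/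
structure IsWindowSystem {T : Type*} (m : MeasurableSpace T) (𝒲 𝒩 : Set (Set T)) : Prop where
  measurable_window : ∀ W ∈ 𝒲, MeasurableSet[m] W
  measurable_null : ∀ N ∈ 𝒩, MeasurableSet[m] N
  empty_mem_null : ∅ ∈ 𝒩
  null_mono : ∀ N ∈ 𝒩, ∀ S : Set T, MeasurableSet[m] S → S ⊆ N → S ∈ 𝒩
  null_iUnion : ∀ f : ℕ → Set T, (∀ n, f n ∈ 𝒩) → (⋃ n, f n) ∈ 𝒩
  window_disjUnion : ∀ W₁ ∈ 𝒲, ∀ W₂ ∈ 𝒲, Disjoint W₁ W₂ → W₁ ∪ W₂ ∈ 𝒲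
  window_null_disjoint : 𝒲 ∩ 𝒩 = ∅
  inter_mem : ∀ A ∈ 𝒲 ∪ 𝒩, ∀ B ∈ 𝒲 ∪ 𝒩, A ∩ B ∈ 𝒲 ∪ 𝒩
  diff_eq_disjUnion : ∀ A ∈ 𝒲 ∪ 𝒩, ∀ B ∈ 𝒲 ∪ 𝒩, ∃ (n : ℕ) (C : Fin n → Set T),
    (∀ i, C i ∈ 𝒲 ∪ 𝒩) ∧ Pairwise (Function.onFun Disjoint C) ∧ A \ B = ⋃ i, C i
  locally_generates : ∀ W ∈ 𝒲, ∀ S : Set T, MeasurableSet[m] S →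
    MeasurableSet[MeasurableSpace.generateFrom (𝒲 ∪ 𝒩)] (S ∩ W)
  covers : ∀ S : Set T, MeasurableSet[m] S → (∀ W ∈ 𝒲, S ∩ W ∈ 𝒩) → S ∈ 𝒩

/-- A windowed distribution system `(𝒲, 𝒩, 𝒟)` on `X`. -/
structure IsWDS {X T : Type*} [MeasurableSpace X]
    (𝒲 𝒩 : Set (Set T)) (𝒟 : Set T → Measure X) : Prop where
  prob : ∀ W ∈ 𝒲, IsProbabilityMeasure (𝒟 W)
  null_invariant : ∀ W₁ ∈ 𝒲, ∀ W₂ ∈ 𝒲, symmDiff W₁ W₂ ∈ 𝒩 → 𝒟 W₁ = 𝒟 W₂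
  continuous : ∀ f : ℕ → Set T, Monotone f → (∀ n, f n ∈ 𝒲) → (⋃ n, f n) ∈ 𝒲 →
    ∀ A : Set X, MeasurableSet A →
      Tendsto (fun n => 𝒟 (f n) A) atTop (𝓝 (𝒟 (⋃ n, f n) A))
  convex : ∀ (n : ℕ) (W : Fin n → Set T), (∀ i, W i ∈ 𝒲) →
    Pairwise (Function.onFun Disjoint W) →
    ∃ l : Fin n → ℝ≥0∞, (∀ i, 0 < l i ∧ l i < ⊤) ∧
      ∀ I : Finset (Fin n), I.Nonempty → (⋃ i ∈ I, W i) ∈ 𝒲 →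
        𝒟 (⋃ i ∈ I, W i) = (∑ i ∈ I, l i)⁻¹ • ∑ i ∈ I, l i • 𝒟 (W i)

/-- The WDS is constant if all window distributions coincide. -/
def IsConstantWDS {X T : Type*} [MeasurableSpace X]
    (𝒲 : Set (Set T)) (𝒟 : Set T → Measure X) : Prop :=
  ∀ W₁ ∈ 𝒲, ∀ W₂ ∈ 𝒲, 𝒟 W₁ = 𝒟 W₂

/-- A measure `P` on `(T, m)` is a compatible time distribution for `(𝒲, 𝒩, 𝒟)`. -/
structure IsCompatibleTimeDistribution {X T : Type*} [MeasurableSpace X]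
    (m : MeasurableSpace T) (𝒲 𝒩 : Set (Set T)) (𝒟 : Set T → Measure X)
    (P : @Measure T m) : Prop where
  pos : ∀ W ∈ 𝒲, 0 < P W ∧ P W < ⊤
  null : ∀ N ∈ 𝒩, P N = 0
  mix : ∀ (n : ℕ) (W : Fin n → Set T), (∀ i, W i ∈ 𝒲) →
    Pairwise (Function.onFun Disjoint W) → (⋃ i, W i) ∈ 𝒲 →
      𝒟 (⋃ i, W i) = (∑ i, P (W i))⁻¹ • ∑ i, P (W i) • 𝒟 (W i)

/-- A finite family of disjoint windows that are atoms of the σ-algebra `m`, and that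
exhaust `T` up to sets in `𝒩`. -/
structure IsWindowAtomFamily {T : Type*} (m : MeasurableSpace T) (𝒲 𝒩 : Set (Set T))
    {n : ℕ} (A : Fin n → Set T) : Prop where
  mem : ∀ i, A i ∈ 𝒲
  disjoint : Pairwise (Function.onFun Disjoint A)
  nonempty : ∀ i, (A i).Nonempty
  atom : ∀ S : Set T, MeasurableSet[m] S → ∀ i, A i ⊆ S ∨ Disjoint (A i) S
  disjoint_null : ∀ N ∈ 𝒩, ∀ i, Disjoint (A i) N
  diff_null : ∀ S : Set T, MeasurableSet[m] S → S \ (⋃ i, A i) ∈ 𝒩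

namespace IsWindowSystem

variable {T : Type*} {m : MeasurableSpace T} {𝒲 𝒩 : Set (Set T)}

theorem null_iUnion_fin (h : IsWindowSystem m 𝒲 𝒩) {n : ℕ} (f : Fin n → Set T)
    (hf : ∀ i, f i ∈ 𝒩) : (⋃ i, f i) ∈ 𝒩 := by
  have key := h.null_iUnion (fun k => if hk : k < n then f ⟨k, hk⟩ else ∅) (by
    intro k
    by_cases hk : k < n
    · simpa [hk] using hf _
    · simpa [hk] using h.empty_mem_null)
  convert key using 1
  ext x
  simp only [mem_iUnion]
  constructor
  · rintro ⟨i, hi⟩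
    exact ⟨i, by simpa [i.2] using hi⟩
  · rintro ⟨k, hk⟩
    by_cases hkn : k < n
    · exact ⟨⟨k, hkn⟩, by simpa [hkn] using hk⟩
    · simp [hkn] at hk

theorem null_union (h : IsWindowSystem m 𝒲 𝒩) {A B : Set T} (hA : A ∈ 𝒩) (hB : B ∈ 𝒩) :
    A ∪ B ∈ 𝒩 := by
  have := h.null_iUnion_fin ![A, B] (by simp [Fin.forall_fin_two, hA, hB])
  convert this using 1
  ext x
  simp [Fin.exists_fin_two]

theorem notMem_null (h : IsWindowSystem m 𝒲 𝒩) {W : Set T} (hW : W ∈ 𝒲) : W ∉ 𝒩 :=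
  fun hN => (h.window_null_disjoint ▸ (⟨hW, hN⟩ : W ∈ 𝒲 ∩ 𝒩) : W ∈ (∅ : Set (Set T)))

theorem nonempty (h : IsWindowSystem m 𝒲 𝒩) {W : Set T} (hW : W ∈ 𝒲) : W.Nonempty := by
  rw [nonempty_iff_ne_empty]
  rintro rfl
  exact h.notMem_null hW h.empty_mem_null

theorem minimal_disjoint_null (h : IsWindowSystem m 𝒲 𝒩) {A : Set T}
    (hA : Minimal (· ∈ 𝒲) A) {N : Set T} (hN : N ∈ 𝒩) : Disjoint A N := by
  obtain ⟨n, C, hC, -, hCe⟩ := h.diff_eq_disjUnion A (.inl hA.prop) N (.inr hN)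
  by_cases hw : ∃ i, C i ∈ 𝒲
  · obtain ⟨i, hi⟩ := hw
    have hsub : C i ⊆ A \ N := hCe ▸ subset_iUnion C i
    have hle : A ⊆ C i := hA.le_of_le hi (hsub.trans sdiff_subset)
    exact Set.disjoint_sdiff_left.mono_left (hle.trans hsub)
  · push Not at hw
    have hnull : A \ N ∈ 𝒩 := hCe ▸ h.null_iUnion_fin C fun i => (hC i).resolve_left (hw i)
    refine (h.notMem_null hA.prop (h.null_mono _ (h.null_union hnull hN) A
      (h.measurable_window A hA.prop) ?_)).elim
    simp

theorem minimal_subset_or_disjoint_window (h : IsWindowSystem m 𝒲 𝒩) {A : Set T}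
    (hA : Minimal (· ∈ 𝒲) A) {W : Set T} (hW : W ∈ 𝒲) : A ⊆ W ∨ Disjoint A W := by
  rcases h.inter_mem A (.inl hA.prop) W (.inl hW) with hi | hi
  · exact .inl ((hA.le_of_le hi inter_subset_left).trans inter_subset_right)
  · have hd := h.minimal_disjoint_null hA hi
    right
    rw [Set.disjoint_left] at hd ⊢
    exact fun x hx hxW => hd hx ⟨hx, hxW⟩

theorem minimal_subset_or_disjoint (h : IsWindowSystem m 𝒲 𝒩) {A : Set T}
    (hA : Minimal (· ∈ 𝒲) A) {S : Set T} (hS : MeasurableSet[m] S) :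
    A ⊆ S ∨ Disjoint A S := by
  have key : ∀ R : Set T, MeasurableSet[MeasurableSpace.generateFrom (𝒲 ∪ 𝒩)] R →
      A ⊆ R ∨ Disjoint A R := by
    intro R hR
    induction R, hR using MeasurableSpace.generateFrom_induction with
    | hC R hR =>
      rcases hR with hR | hR
      · exact h.minimal_subset_or_disjoint_window hA hR
      · exact .inr (h.minimal_disjoint_null hA hR)
    | empty => exact .inr (disjoint_empty A)
    | compl R _ ih =>
      rcases ih with ih | ih
      · exact .inr (disjoint_compl_right.mono_left ih)
      · exact .inl ih.subset_compl_right
    | iUnion f _ ih =>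
      by_cases hex : ∃ k, A ⊆ f k
      · obtain ⟨k, hk⟩ := hex
        exact .inl (hk.trans (subset_iUnion f k))
      · push Not at hex
        exact .inr (disjoint_iUnion_right.2 fun k => (ih k).resolve_left (hex k))
  rcases key _ (h.locally_generates A hA.prop S hS) with hs | hd
  · exact .inl (hs.trans inter_subset_left)
  · right
    rw [Set.disjoint_left] at hd ⊢
    exact fun x hx hxS => hd hx ⟨hxS, hx⟩

theorem window_diff_minimal_null (h : IsWindowSystem m 𝒲 𝒩) (hfin : 𝒲.Finite)
    {W : Set T} (hW : W ∈ 𝒲) : W \ ⋃₀ {A | Minimal (· ∈ 𝒲) A} ∈ 𝒩 := by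
  set U := ⋃₀ {A | Minimal (· ∈ 𝒲) A}
  by_contra hcon
  obtain ⟨V, hV⟩ := (hfin.subset (sep_subset 𝒲 fun W => W \ U ∉ 𝒩)).exists_minimal ⟨W, hW, hcon⟩
  have hVW := hV.prop.1
  have small : ∀ B ∈ 𝒲, B ⊂ V → B \ U ∈ 𝒩 := by
    intro B hB hBV
    by_contra hBN
    exact hBV.2 (hV.le_of_le ⟨hB, hBN⟩ hBV.1)
  by_cases hmin : Minimal (· ∈ 𝒲) V
  · refine hV.prop.2 ?_
    rw [sdiff_eq_empty.2 (subset_sUnion_of_mem hmin)]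
    exact h.empty_mem_null
  · obtain ⟨B, hBV, hB⟩ : ∃ B, B ⊂ V ∧ B ∈ 𝒲 := by
      simpa [not_minimal_iff_exists_lt hVW] using hmin
    obtain ⟨n, C, hC, -, hCe⟩ := h.diff_eq_disjUnion V (.inl hVW) B (.inl hB)
    have hmeasU : ∀ R, MeasurableSet[m] R → MeasurableSet[m] (R \ U) := fun R hR =>
      hR.diff (MeasurableSet.sUnion (hfin.subset fun A hA => hA.prop).countable
        fun A hA => h.measurable_window A hA.prop)
    have hCnull : ∀ i, C i \ U ∈ 𝒩 := by
      intro i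
      rcases hC i with hi | hi
      · have hsub : C i ⊆ V \ B := hCe ▸ subset_iUnion C i
        refine small _ hi ⟨hsub.trans sdiff_subset, fun hle => ?_⟩
        obtain ⟨x, hx⟩ := h.nonempty hB
        exact (hsub (hle (hBV.1 hx))).2 hx
      · exact h.null_mono _ hi _ (hmeasU _ (h.measurable_null _ hi)) sdiff_subset
    refine hV.prop.2 ?_
    have hVe : V \ U = (B \ U) ∪ ⋃ i, C i \ U := by
      rw [← iUnion_sdiff, ← hCe, ← union_sdiff_distrib, union_sdiff_cancel hBV.1]
    rw [hVe]
    exact h.null_union (small B hB hBV) (h.null_iUnion_fin _ hCnull)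

theorem exists_atomFamily (h : IsWindowSystem m 𝒲 𝒩) (hfin : 𝒲.Finite) :
    ∃ (n : ℕ) (A : Fin n → Set T), IsWindowAtomFamily m 𝒲 𝒩 A := by
  have hminfin : {A | Minimal (· ∈ 𝒲) A}.Finite := hfin.subset fun A hA => hA.prop
  obtain ⟨n, A, hAinj, hA⟩ := hminfin.fin_param
  have hmin : ∀ i, Minimal (· ∈ 𝒲) (A i) := fun i => by
    have : A i ∈ range A := mem_range_self i
    rwa [hA] at this
  refine ⟨n, A, fun i => (hmin i).prop, fun i j hij => ?_, fun i => h.nonempty (hmin i).prop,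
    fun S hS i => h.minimal_subset_or_disjoint (hmin i) hS,
    fun N hN i => h.minimal_disjoint_null (hmin i) hN, fun S hS => ?_⟩
  · refine (h.minimal_subset_or_disjoint_window (hmin i) (hmin j).prop).resolve_left fun hs => ?_
    exact hij (hAinj (hs.antisymm ((hmin j).le_of_le (hmin i).prop hs)))
  · have hmeas : MeasurableSet[m] (S \ ⋃ i, A i) :=
      hS.diff (MeasurableSet.iUnion fun i => h.measurable_window _ (hmin i).prop)
    refine h.covers _ hmeas fun W hW => h.null_mono _ (h.window_diff_minimal_null hfin hW) _
      (hmeas.inter (h.measurable_window W hW)) ?_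
    rw [← hA, sUnion_range]
    exact fun x hx => ⟨hx.2, hx.1.2⟩

end IsWindowSystem

section AtomFamily

variable {X T : Type*} [MeasurableSpace X] {m : MeasurableSpace T} {𝒲 𝒩 : Set (Set T)}
  {𝒟 : Set T → Measure X} {n : ℕ} {A : Fin n → Set T}

open Classical in
/-- The indices of the atoms contained in `S`. -/
noncomputable def atomsIn (A : Fin n → Set T) (S : Set T) : Finset (Fin n) :=
  Finset.univ.filter fun i => A i ⊆ S

theorem mem_atomsIn {S : Set T} {i : Fin n} : i ∈ atomsIn A S ↔ A i ⊆ S := by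
  simp [atomsIn]

namespace IsWindowAtomFamily

theorem diff_atomsIn_null (hA : IsWindowAtomFamily m 𝒲 𝒩 A) {S : Set T}
    (hS : MeasurableSet[m] S) : S \ (⋃ i ∈ atomsIn A S, A i) ∈ 𝒩 := by
  convert hA.diff_null S hS using 1
  ext x
  simp only [Set.mem_sdiff, mem_iUnion, mem_atomsIn, not_exists]
  refine and_congr_right fun hx => ⟨fun hn i hi => ?_, fun hn i _ => hn i⟩
  exact hn i ((hA.atom S hS i).resolve_right fun hd => Set.disjoint_left.1 hd hi hx) hi

theorem atomsIn_nonempty (hA : IsWindowAtomFamily m 𝒲 𝒩 A) (h : IsWindowSystem m 𝒲 𝒩)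
    {W : Set T} (hW : W ∈ 𝒲) : (atomsIn A W).Nonempty := by
  rw [Finset.nonempty_iff_ne_empty]
  intro he
  have := hA.diff_atomsIn_null (h.measurable_window W hW)
  simp only [he, Finset.notMem_empty, iUnion_false, iUnion_empty, sdiff_empty] at this
  exact h.notMem_null hW this

theorem biUnion_mem (hA : IsWindowAtomFamily m 𝒲 𝒩 A) (h : IsWindowSystem m 𝒲 𝒩)
    {I : Finset (Fin n)} (hI : I.Nonempty) : (⋃ i ∈ I, A i) ∈ 𝒲 := by
  induction hI using Finset.Nonempty.cons_induction with
  | singleton i => simpa using hA.mem i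
  | cons i s hi hs ih =>
    simp only [Finset.mem_cons, iUnion_iUnion_eq_or_left]
    refine h.window_disjUnion _ (hA.mem i) _ ih ?_
    simp only [disjoint_iUnion_right]
    exact fun j hj => hA.disjoint fun hij => hi (hij ▸ hj)

theorem distribution_eq (hA : IsWindowAtomFamily m 𝒲 𝒩 A) (h : IsWindowSystem m 𝒲 𝒩)
    (hD : IsWDS 𝒲 𝒩 𝒟) {W : Set T} (hW : W ∈ 𝒲) :
    𝒟 W = 𝒟 (⋃ i ∈ atomsIn A W, A i) := by
  have hsub : (⋃ i ∈ atomsIn A W, A i) ⊆ W := iUnion₂_subset fun i hi => mem_atomsIn.1 hi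
  refine hD.null_invariant W hW _ (hA.biUnion_mem h (hA.atomsIn_nonempty h hW)) ?_
  rw [Set.symmDiff_def, sdiff_eq_empty.2 hsub, union_empty]
  exact hA.diff_atomsIn_null (h.measurable_window W hW)

theorem exists_distribution_ne (hA : IsWindowAtomFamily m 𝒲 𝒩 A) (h : IsWindowSystem m 𝒲 𝒩)
    (hD : IsWDS 𝒲 𝒩 𝒟) (hnc : ¬ IsConstantWDS 𝒲 𝒟) (i : Fin n) :
    ∃ k, 𝒟 (A k) ≠ 𝒟 (A i) := by
  by_contra! hall
  obtain ⟨l, hl, hmix⟩ := hD.convex n A hA.mem hA.disjoint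
  have key : ∀ W ∈ 𝒲, 𝒟 W = 𝒟 (A i) := by
    intro W hW
    have hne := hA.atomsIn_nonempty h hW
    rw [hA.distribution_eq h hD hW, hmix _ hne (hA.biUnion_mem h hne)]
    simp only [hall, ← Finset.sum_smul, smul_smul]
    rw [ENNReal.inv_mul_cancel, one_smul]
    · obtain ⟨j, hj⟩ := hne
      exact fun h0 => (hl j).1.ne' (Finset.sum_eq_zero_iff.1 h0 j hj)
    · exact ENNReal.sum_ne_top.2 fun j _ => (hl j).2.ne
  exact hnc fun W₁ h₁ W₂ h₂ => (key W₁ h₁).trans (key W₂ h₂).symm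

theorem measure_eq_sum (hA : IsWindowAtomFamily m 𝒲 𝒩 A) (h : IsWindowSystem m 𝒲 𝒩)
    {P : @Measure T m} (hP : ∀ N ∈ 𝒩, P N = 0) {S : Set T} (hS : MeasurableSet[m] S) :
    P S = ∑ i ∈ atomsIn A S, P (A i) := by
  have hsub : (⋃ i ∈ atomsIn A S, A i) ⊆ S := iUnion₂_subset fun i hi => mem_atomsIn.1 hi
  rw [← measure_biUnion_finset (fun i _ j _ hij => hA.disjoint hij)
    fun i _ => h.measurable_window _ (hA.mem i)]
  refine le_antisymm ?_ (measure_mono hsub)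
  calc P S ≤ P ((⋃ i ∈ atomsIn A S, A i) ∪ S \ (⋃ i ∈ atomsIn A S, A i)) :=
        measure_mono (by rw [union_sdiff_cancel hsub])
    _ ≤ P (⋃ i ∈ atomsIn A S, A i) + P (S \ (⋃ i ∈ atomsIn A S, A i)) := measure_union_le _ _
    _ = P (⋃ i ∈ atomsIn A S, A i) := by rw [hP _ (hA.diff_atomsIn_null hS), add_zero]

end IsWindowAtomFamily

theorem IsCompatibleTimeDistribution.mix_pair {P : @Measure T m}
    (hP : IsCompatibleTimeDistribution m 𝒲 𝒩 𝒟 P) {U V : Set T} (hU : U ∈ 𝒲) (hV : V ∈ 𝒲)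
    (hUV : Disjoint U V) (hmem : U ∪ V ∈ 𝒲) :
    𝒟 (U ∪ V) = (P U + P V)⁻¹ • (P U • 𝒟 U + P V • 𝒟 V) := by
  have hun : (⋃ i, (![U, V] : Fin 2 → Set T) i) = U ∪ V := by
    ext x
    simp [Fin.exists_fin_two]
  have := hP.mix 2 ![U, V] (by simp [Fin.forall_fin_two, hU, hV])
    (by
      intro i j hij
      fin_cases i <;> fin_cases j <;> simp_all [Function.onFun, hUV.symm])
    (by rwa [hun])
  rw [hun] at this
  simpa [Fin.sum_univ_two] using this

theorem cross_mul_of_weighted_eq {p q p' q' a b : ℝ} (hp : 0 < p) (hq : 0 < q) (hp' : 0 < p')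
    (hq' : 0 < q') (hab : a ≠ b)
    (h : (p + q)⁻¹ * (p * a + q * b) = (p' + q')⁻¹ * (p' * a + q' * b)) :
    p * q' = p' * q := by
  field_simp at h
  have : (a - b) * (p * q' - p' * q) = 0 := by linear_combination h
  rcases mul_eq_zero.1 this with h0 | h0
  · exact (hab (sub_eq_zero.1 h0)).elim
  · exact sub_eq_zero.1 h0

theorem IsCompatibleTimeDistribution.cross_mul_of_ne (h : IsWindowSystem m 𝒲 𝒩)
    (hD : IsWDS 𝒲 𝒩 𝒟) {P Q : @Measure T m}
    (hP : IsCompatibleTimeDistribution m 𝒲 𝒩 𝒟 P) (hQ : IsCompatibleTimeDistribution m 𝒲 𝒩 𝒟 Q)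
    {U V : Set T} (hU : U ∈ 𝒲) (hV : V ∈ 𝒲) (hUV : Disjoint U V) (hne : 𝒟 U ≠ 𝒟 V) :
    P U * Q V = Q U * P V := by
  have hmem := h.window_disjUnion U hU V hV hUV
  have heq := (hP.mix_pair hU hV hUV hmem).symm.trans (hQ.mix_pair hU hV hUV hmem)
  obtain ⟨E, hE, hEne⟩ : ∃ E, MeasurableSet E ∧ 𝒟 U E ≠ 𝒟 V E := by
    by_contra! hall
    exact hne (Measure.ext hall)
  have := hD.prob U hU
  have := hD.prob V hV
  have heqE := congrArg (fun μ : Measure X => (μ E).toReal) heq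
  have toReal_eq : ∀ R : @Measure T m, IsCompatibleTimeDistribution m 𝒲 𝒩 𝒟 R →
      (((R U + R V)⁻¹ • (R U • 𝒟 U + R V • 𝒟 V)) E).toReal =
        ((R U).toReal + (R V).toReal)⁻¹ *
          ((R U).toReal * (𝒟 U E).toReal + (R V).toReal * (𝒟 V E).toReal) := by
    intro R hR
    have hRU := (hR.pos U hU).2.ne
    have hRV := (hR.pos V hV).2.ne
    simp only [Measure.smul_apply, Measure.add_apply, smul_eq_mul, ENNReal.toReal_mul,
      ENNReal.toReal_inv]
    rw [ENNReal.toReal_add hRU hRV, ENNReal.toReal_add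
      (ENNReal.mul_ne_top hRU (measure_ne_top _ _)) (ENNReal.mul_ne_top hRV (measure_ne_top _ _)),
      ENNReal.toReal_mul, ENNReal.toReal_mul]
  simp only [toReal_eq P hP, toReal_eq Q hQ] at heqE
  have pos : ∀ R : @Measure T m, IsCompatibleTimeDistribution m 𝒲 𝒩 𝒟 R →
      ∀ W ∈ 𝒲, 0 < (R W).toReal := fun R hR W hW =>
    ENNReal.toReal_pos (hR.pos W hW).1.ne' (hR.pos W hW).2.ne
  have hcross := cross_mul_of_weighted_eq (pos P hP U hU) (pos P hP V hV) (pos Q hQ U hU)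
    (pos Q hQ V hV)
    (fun he => hEne ((ENNReal.toReal_eq_toReal_iff' (measure_ne_top _ _)
      (measure_ne_top _ _)).1 he)) heqE
  rw [← ENNReal.toReal_mul, ← ENNReal.toReal_mul] at hcross
  exact (ENNReal.toReal_eq_toReal_iff'
    (ENNReal.mul_ne_top (hP.pos U hU).2.ne (hQ.pos V hV).2.ne)
    (ENNReal.mul_ne_top (hQ.pos U hU).2.ne (hP.pos V hV).2.ne)).1 hcross

theorem IsWindowAtomFamily.cross_mul (hA : IsWindowAtomFamily m 𝒲 𝒩 A)
    (h : IsWindowSystem m 𝒲 𝒩) (hD : IsWDS 𝒲 𝒩 𝒟) (hnc : ¬ IsConstantWDS 𝒲 𝒟)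
    {P Q : @Measure T m} (hP : IsCompatibleTimeDistribution m 𝒲 𝒩 𝒟 P)
    (hQ : IsCompatibleTimeDistribution m 𝒲 𝒩 𝒟 Q) (i j : Fin n) :
    P (A i) * Q (A j) = Q (A i) * P (A j) := by
  have of_ne : ∀ i j, 𝒟 (A i) ≠ 𝒟 (A j) → P (A i) * Q (A j) = Q (A i) * P (A j) :=
    fun i j hij => hP.cross_mul_of_ne h hD hQ (hA.mem i) (hA.mem j)
      (hA.disjoint fun he => hij (he ▸ rfl)) hij
  by_cases hij : 𝒟 (A i) = 𝒟 (A j)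
  · obtain ⟨k, hk⟩ := hA.exists_distribution_ne h hD hnc i
    have h1 := of_ne i k hk.symm
    have h2 := of_ne k j (hij ▸ hk)
    have hPk := hP.pos _ (hA.mem k)
    have hQk := hQ.pos _ (hA.mem k)
    have h3 : (P (A k) * Q (A k)) * (P (A i) * Q (A j)) =
        (P (A k) * Q (A k)) * (Q (A i) * P (A j)) :=
      calc _ = (P (A i) * Q (A k)) * (P (A k) * Q (A j)) := by ring
        _ = _ := by rw [h1, h2]; ring
    exact (ENNReal.mul_right_inj (mul_ne_zero hPk.1.ne' hQk.1.ne')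
      (ENNReal.mul_ne_top hPk.2.ne hQk.2.ne)).1 h3
  · exact of_ne i j hij

theorem IsCompatibleTimeDistribution.unique (h : IsWindowSystem m 𝒲 𝒩)
    (hD : IsWDS 𝒲 𝒩 𝒟) (hfin : 𝒲.Finite) (hnc : ¬ IsConstantWDS 𝒲 𝒟)
    {W : Set T} (hW : W ∈ 𝒲) {P Q : @Measure T m}
    (hP : IsCompatibleTimeDistribution m 𝒲 𝒩 𝒟 P) (hPW : P W = 1)
    (hQ : IsCompatibleTimeDistribution m 𝒲 𝒩 𝒟 Q) (hQW : Q W = 1) : P = Q := by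
  obtain ⟨n, A, hA⟩ := h.exists_atomFamily hfin
  have hWm := h.measurable_window W hW
  have hatom : ∀ i, P (A i) = Q (A i) := by
    intro i
    have hsum : ∑ j ∈ atomsIn A W, P (A i) * Q (A j) = ∑ j ∈ atomsIn A W, Q (A i) * P (A j) :=
      Finset.sum_congr rfl fun j _ => hA.cross_mul h hD hnc hP hQ i j
    rwa [← Finset.mul_sum, ← Finset.mul_sum, ← hA.measure_eq_sum h hP.null hWm,
      ← hA.measure_eq_sum h hQ.null hWm, hPW, hQW, mul_one, mul_one] at hsum
  refine Measure.ext fun S hS => ?_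
  rw [hA.measure_eq_sum h hP.null hS, hA.measure_eq_sum h hQ.null hS]
  exact Finset.sum_congr rfl fun i _ => hatom i

theorem IsCompatibleTimeDistribution.smul {P : @Measure T m}
    (hP : IsCompatibleTimeDistribution m 𝒲 𝒩 𝒟 P) {c : ℝ≥0∞} (hc : c ≠ 0) (hc' : c ≠ ⊤) :
    IsCompatibleTimeDistribution m 𝒲 𝒩 𝒟 (c • P) where
  pos W hW := by
    obtain ⟨h1, h2⟩ := hP.pos W hW
    simp only [Measure.smul_apply, smul_eq_mul]
    exact ⟨ENNReal.mul_pos hc h1.ne', ENNReal.mul_lt_top hc'.lt_top h2⟩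
  null N hN := by simp [hP.null N hN]
  mix n W hW hdisj hmem := by
    rw [hP.mix n W hW hdisj hmem]
    simp only [Measure.smul_apply, smul_eq_mul, ← smul_smul, ← Finset.smul_sum, ← Finset.mul_sum]
    rw [smul_smul _ c, ENNReal.mul_inv (.inl hc) (.inl hc'), mul_comm c⁻¹, mul_assoc,
      ENNReal.inv_mul_cancel hc hc', mul_one]

theorem IsWindowAtomFamily.atomsIn_iUnion (hA : IsWindowAtomFamily m 𝒲 𝒩 A) {k : ℕ}
    {W : Fin k → Set T} (hW : ∀ j, MeasurableSet[m] (W j)) :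
    atomsIn A (⋃ j, W j) = Finset.univ.biUnion fun j => atomsIn A (W j) := by
  ext i
  simp only [mem_atomsIn, Finset.mem_biUnion, Finset.mem_univ, true_and]
  refine ⟨fun hi => ?_, fun ⟨j, hj⟩ => hj.trans (subset_iUnion W j)⟩
  obtain ⟨x, hx⟩ := hA.nonempty i
  obtain ⟨j, hj⟩ := mem_iUnion.1 (hi hx)
  exact ⟨j, (hA.atom _ (hW j) i).resolve_right fun hd => Set.disjoint_left.1 hd hx hj⟩

theorem IsWindowAtomFamily.disjoint_atomsIn (hA : IsWindowAtomFamily m 𝒲 𝒩 A) {U V : Set T}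
    (hUV : Disjoint U V) : Disjoint (atomsIn A U) (atomsIn A V) := by
  rw [Finset.disjoint_left]
  intro i hU hV
  obtain ⟨x, hx⟩ := hA.nonempty i
  exact Set.disjoint_left.1 hUV (mem_atomsIn.1 hU hx) (mem_atomsIn.1 hV hx)

theorem IsWindowAtomFamily.exists_compatible (hA : IsWindowAtomFamily m 𝒲 𝒩 A)
    (h : IsWindowSystem m 𝒲 𝒩) (hD : IsWDS 𝒲 𝒩 𝒟) :
    ∃ P : @Measure T m, IsCompatibleTimeDistribution m 𝒲 𝒩 𝒟 P := by
  classical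
  obtain ⟨l, hl, hmix⟩ := hD.convex n A hA.mem hA.disjoint
  choose t ht using hA.nonempty
  have hmem : ∀ S, MeasurableSet[m] S → ∀ i, t i ∈ S ↔ A i ⊆ S := fun S hS i =>
    ⟨fun hi => (hA.atom S hS i).resolve_right fun hd => Set.disjoint_left.1 hd (ht i) hi,
      fun hi => hi (ht i)⟩
  let P : @Measure T m := ∑ i, l i • Measure.dirac (t i)
  have hP : ∀ S, MeasurableSet[m] S → P S = ∑ i ∈ atomsIn A S, l i := by
    intro S hS
    simp only [P, Measure.finsetSum_apply, Measure.smul_apply, smul_eq_mul,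
      Measure.dirac_apply' _ hS, atomsIn, Finset.sum_filter, Set.indicator_apply, hmem S hS,
      Pi.one_apply, mul_ite, mul_one, mul_zero]
  have hpos : ∀ W ∈ 𝒲, 0 < P W ∧ P W < ⊤ := by
    intro W hW
    rw [hP W (h.measurable_window W hW)]
    obtain ⟨i, hi⟩ := hA.atomsIn_nonempty h hW
    exact ⟨(hl i).1.trans_le (Finset.single_le_sum (fun _ _ => zero_le) hi),
      ENNReal.sum_lt_top.2 fun j _ => (hl j).2⟩
  have hmass : ∀ W ∈ 𝒲, P W • 𝒟 W = ∑ i ∈ atomsIn A W, l i • 𝒟 (A i) := by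
    intro W hW
    have hne := hA.atomsIn_nonempty h hW
    rw [hA.distribution_eq h hD hW, hmix _ hne (hA.biUnion_mem h hne),
      ← hP W (h.measurable_window W hW), smul_smul,
      ENNReal.mul_inv_cancel (hpos W hW).1.ne' (hpos W hW).2.ne, one_smul]
  refine ⟨P, hpos, fun N hN => ?_, fun k W hW hdisj hU => ?_⟩
  · rw [hP N (h.measurable_null N hN)]
    refine Finset.sum_eq_zero fun i hi => ?_
    exact (Set.disjoint_left.1 (hA.disjoint_null N hN i) (ht i) (mem_atomsIn.1 hi (ht i))).elim
  · have hWm := fun j => h.measurable_window _ (hW j)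
    have hsum : ∑ j, P (W j) • 𝒟 (W j) = P (⋃ j, W j) • 𝒟 (⋃ j, W j) := by
      rw [hmass _ hU, hA.atomsIn_iUnion hWm,
        Finset.sum_biUnion fun i _ j _ hij => hA.disjoint_atomsIn (hdisj hij)]
      exact Finset.sum_congr rfl fun j _ => hmass _ (hW j)
    have hPU : ∑ j, P (W j) = P (⋃ j, W j) := by
      rw [measure_iUnion hdisj hWm, tsum_fintype]
    rw [hsum, hPU, smul_smul, ENNReal.inv_mul_cancel (hpos _ hU).1.ne' (hpos _ hU).2.ne, one_smul]

end AtomFamily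

theorem IsCompatibleTimeDistribution.trim {X T : Type*} [MeasurableSpace X]
    {m m₀ : MeasurableSpace T} (hm : m ≤ m₀) {𝒲 𝒩 𝒲' 𝒩' : Set (Set T)} {𝒟 : Set T → Measure X}
    (h : IsWindowSystem m 𝒲' 𝒩') (hW : 𝒲' ⊆ 𝒲) (hN : 𝒩' ⊆ 𝒩) {P : @Measure T m₀}
    (hP : IsCompatibleTimeDistribution m₀ 𝒲 𝒩 𝒟 P) :
    IsCompatibleTimeDistribution m 𝒲' 𝒩' 𝒟 (P.trim hm) where
  pos V hV := by
    rw [trim_measurableSet_eq hm (h.measurable_window V hV)]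
    exact hP.pos V (hW hV)
  null N hN' := by
    rw [trim_measurableSet_eq hm (h.measurable_null N hN')]
    exact hP.null N (hN hN')
  mix k V hV hdisj hmem := by
    simp only [trim_measurableSet_eq hm (h.measurable_window _ (hV _))]
    exact hP.mix k V (fun i => hW (hV i)) hdisj (hW hmem)

/-- Let `(𝒲, 𝒩, 𝒟)` be a non-constant WDS over a window system on
`(T, m₀)` with `𝒲` finite, and fix `W* ∈ 𝒲`. Then there is a unique measure `P` on `m₀`
compatible with the WDS and with `P W* = 1`. Moreover, for any non-constant WDS
`(𝒲', 𝒩', 𝒟)` over a window system on a coarser σ-algebra `m ≤ m₀` with `W* ∈ 𝒲' ⊆ 𝒲`,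
`𝒩' ⊆ 𝒩` and the same window distributions, the corresponding measure `P'` is the
restriction of `P` to `m`. -/
theorem finite_wds_unique_compatible_measure
    {X T : Type*} [MeasurableSpace X] (m₀ : MeasurableSpace T)
    (𝒲 𝒩 : Set (Set T)) (𝒟 : Set T → Measure X)
    (hWS : IsWindowSystem m₀ 𝒲 𝒩) (hWDS : IsWDS 𝒲 𝒩 𝒟)
    (hfin : 𝒲.Finite) (hnc : ¬ IsConstantWDS 𝒲 𝒟)
    (Wstar : Set T) (hWstar : Wstar ∈ 𝒲) :
    (∃! P : @Measure T m₀, IsCompatibleTimeDistribution m₀ 𝒲 𝒩 𝒟 P ∧ P Wstar = 1) ∧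
    (∀ (m : MeasurableSpace T), m ≤ m₀ → ∀ 𝒲' 𝒩' : Set (Set T),
      IsWindowSystem m 𝒲' 𝒩' → IsWDS 𝒲' 𝒩' 𝒟 → ¬ IsConstantWDS 𝒲' 𝒟 →
      Wstar ∈ 𝒲' → 𝒲' ⊆ 𝒲 → 𝒩' ⊆ 𝒩 →
      ∀ (P : @Measure T m₀) (P' : @Measure T m),
        IsCompatibleTimeDistribution m₀ 𝒲 𝒩 𝒟 P → P Wstar = 1 →
        IsCompatibleTimeDistribution m 𝒲' 𝒩' 𝒟 P' → P' Wstar = 1 →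
        ∀ S : Set T, MeasurableSet[m] S → P' S = P S) := by
  refine ⟨?_, ?_⟩
  · obtain ⟨n, A, hA⟩ := hWS.exists_atomFamily hfin
    obtain ⟨P, hP⟩ := hA.exists_compatible hWS hWDS
    obtain ⟨hpos, hlt⟩ := hP.pos Wstar hWstar
    refine ⟨(P Wstar)⁻¹ • P, ⟨hP.smul (ENNReal.inv_ne_zero.2 hlt.ne)
      (ENNReal.inv_ne_top.2 hpos.ne'), ?_⟩, fun Q hQ => ?_⟩
    · rw [Measure.smul_apply, smul_eq_mul, ENNReal.inv_mul_cancel hpos.ne' hlt.ne]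
    · refine hQ.1.unique hWS hWDS hfin hnc hWstar hQ.2 (hP.smul (ENNReal.inv_ne_zero.2 hlt.ne)
        (ENNReal.inv_ne_top.2 hpos.ne')) ?_
      rw [Measure.smul_apply, smul_eq_mul, ENNReal.inv_mul_cancel hpos.ne' hlt.ne]
  · intro m hm 𝒲' 𝒩' hWS' hWDS' hnc' hWstar' hW hN P P' hP hP1 hP' hP1' S hS
    have heq := hP'.unique hWS' hWDS' (hfin.subset hW) hnc' hWstar' hP1' (hP.trim hm hWS' hW hN)
      (by rw [trim_measurableSet_eq hm (hWS'.measurable_window _ hWstar'), hP1])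
    rw [heq, trim_measurableSet_eq hm hS]
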